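/- Let (𝒜, ℬ, 𝒞) be a recollement of abelian categories such that 𝒜 is a finite length category, ℬ has enough projectives and projective covers, and 𝒞 has enough projectives. Assume there is t < ∞ such that id_ℬ i(A) ≤ t for every object A of 𝒜. Then every object B of ℬ has a projective resolution of the form ⋯ → l(Q₁) → l(Q₀) → P_t → ⋯ → P₀ → B → 0, where each Q_j is a projective object of 𝒞 and each P_i is a projective object of ℬ. -/

import Mathlib

/-!
A recollement `(𝒜, ℬ, 𝒞)` of abelian categories consists of functors `i : 𝒜 ⥤ ℬ`,
`e : ℬ ⥤ 𝒞`, `q, p : ℬ ⥤ 𝒜` and `l, r : 𝒞 ⥤ ℬ` such that `(l, e)`, `(e, r)`, `(q, i)`,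
`(i, p)` are adjoint pairs, the functors `i`, `l` and `r` are fully faithful, and the
essential image of `i` equals the kernel of `e`.

STATEMENT: suppose `𝒜` is a finite length category, `ℬ` has enough projectives and
projective covers, `𝒞` has enough projectives, and there is `t < ∞` with `id_ℬ i(A) ≤ t`
for every `A ∈ 𝒜`.  Then every object `B` of `ℬ` has a projective resolution of the form
`⋯ → l(Q₁) → l(Q₀) → P_t → ⋯ → P₀ → B → 0` with each `Q_j` projective in `𝒞` and each
`P_i` projective in `ℬ` (i.e. a projective resolution whose terms in all degrees `> t`
are of the form `l(Q)` with `Q` projective in `𝒞`).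
-/

open CategoryTheory CategoryTheory.Limits

universe w v₁ v₂ v₃ u₁ u₂ u₃

/-- A recollement `(𝒜, ℬ, 𝒞)` of abelian categories. -/
structure Recollement (A : Type u₁) (B : Type u₂) (C : Type u₃)
    [Category.{v₁} A] [Category.{v₂} B] [Category.{v₃} C]
    [Abelian A] [Abelian B] [Abelian C] where
  /-- the inclusion functor -/
  i : A ⥤ B
  /-- the quotient functor -/
  e : B ⥤ C
  /-- the left adjoint of `i` -/
  q : B ⥤ A
  /-- the right adjoint of `i` -/
  p : B ⥤ A
  /-- the left adjoint of `e` -/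
  l : C ⥤ B
  /-- the right adjoint of `e` -/
  r : C ⥤ B
  /-- `(l, e)` is an adjoint pair -/
  adj_le : l ⊣ e
  /-- `(e, r)` is an adjoint pair -/
  adj_er : e ⊣ r
  /-- `(q, i)` is an adjoint pair -/
  adj_qi : q ⊣ i
  /-- `(i, p)` is an adjoint pair -/
  adj_ip : i ⊣ p
  i_full : i.Full
  i_faithful : i.Faithful
  l_full : l.Full
  l_faithful : l.Faithful
  r_full : r.Full
  r_faithful : r.Faithful
  /-- the essential image of `i` is the kernel of `e` -/
  essImage_i_eq_ker_e : ∀ X : B, i.essImage X ↔ IsZero (e.obj X)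

/-- The projective dimension of an object of an abelian category, as an element of `ℕ∞`:
the least `n` such that `X` admits a projective resolution
`0 → P_n → ⋯ → P_0 → X → 0` (and `⊤` if there is no such `n`). -/
noncomputable def projDim {C : Type u₁} [Category.{v₁} C] [Abelian C] (X : C) : ℕ∞ :=
  ⨅ (n : ℕ) (_ : ∃ P : CategoryTheory.ProjectiveResolution X,
    ∀ k, n < k → IsZero (P.complex.X k)), (n : ℕ∞)

/-- The injective dimension of an object of an abelian category, as an element of `ℕ∞`:
the least `n` such that `X` admits an injective coresolution
`0 → X → I^0 → ⋯ → I^n → 0` (and `⊤` if there is no such `n`). -/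
noncomputable def injDim {C : Type u₁} [Category.{v₁} C] [Abelian C] (X : C) : ℕ∞ :=
  ⨅ (n : ℕ) (_ : ∃ I : CategoryTheory.InjectiveResolution X,
    ∀ k, n < k → IsZero (I.cocomplex.X k)), (n : ℕ∞)

/-- The finitistic projective dimension of an abelian category: the supremum of the
projective dimensions of the objects having finite projective dimension. -/
noncomputable def catFindim (C : Type u₁) [Category.{v₁} C] [Abelian C] : ℕ∞ :=
  ⨆ (X : C) (_ : projDim X ≠ ⊤), projDim X

/-- An object of an abelian category has finite length if it admits a finite filtration
`⊥ = X_0 < X_1 < ⋯ < X_n = ⊤` by subobjects whose successive quotients are simple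
(a finite composition series). -/
def FiniteLengthObj {C : Type u₁} [Category.{v₁} C] [Abelian C] (X : C) : Prop :=
  ∃ (n : ℕ) (f : Fin (n + 1) → Subobject X), f 0 = ⊥ ∧ f (Fin.last n) = ⊤ ∧
    ∀ j : Fin n, ∃ h : f j.castSucc ≤ f j.succ,
      Simple (cokernel (Subobject.ofLE (f j.castSucc) (f j.succ) h))

/-- An abelian category is a finite length category if every object has a finite
composition series. -/
def FiniteLengthCategory (C : Type u₁) [Category.{v₁} C] [Abelian C] : Prop :=
  ∀ X : C, FiniteLengthObj X

/-- An abelian category has projective covers if every object `X` admits an epimorphism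
`f : P → X` with `P` projective whose kernel is superfluous, i.e. contained in the radical
of `P` (the intersection of all maximal subobjects of `P`). -/
def HasProjectiveCovers (C : Type u₁) [Category.{v₁} C] [Abelian C] : Prop :=
  ∀ X : C, ∃ (P : C) (_ : Projective P) (f : P ⟶ X), Epi f ∧
    ∀ m : Subobject P, IsCoatom m → kernelSubobject f ≤ m


section Auxiliary

universe v u

variable {D : Type u} [Category.{v} D] [Abelian D]

theorem isCoatom_kernelSubobject_of_simple {P T : D} [Simple T] {g : P ⟶ T} (hg : g ≠ 0) :
    IsCoatom (kernelSubobject g) := by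
  have : Epi g := epi_of_nonzero_to_simple hg
  refine ⟨fun hK ↦ hg ?_, fun M hM ↦ ?_⟩
  · have : IsIso (kernelSubobject g).arrow := by rw [Subobject.isIso_iff_mk_eq_top]; simpa using hK
    rw [← cancel_epi (kernelSubobject g).arrow, kernelSubobject_arrow_comp, comp_zero]
  · have hMg : M.arrow ≫ g ≠ 0 := fun h0 ↦ hM.not_ge (by
      simpa using le_kernelSubobject g M h0)
    have : Epi (M.arrow ≫ g) := epi_of_nonzero_to_simple hMg
    have : Epi M.arrow := by
      refine Preadditive.epi_of_cancel_zero _ fun {Z} h h0 ↦ ?_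
      have hK : kernel.ι g ≫ h = 0 := by
        rw [← kernelSubobject_arrow', ← Subobject.ofLE_arrow hM.le, Category.assoc,
          Category.assoc, h0, comp_zero, comp_zero]
      rw [← Abelian.comp_epiDesc g h hK] at h0 ⊢
      rw [← Category.assoc] at h0
      rw [zero_of_epi_comp _ h0, comp_zero]
    have : IsIso M.arrow := isIso_of_mono_of_epi _
    exact Subobject.eq_top_of_isIso_arrow M

/-- A map out of a projective cover to a simple object vanishes on the kernel of the cover. -/
theorem kernel_ι_comp_eq_zero_of_simple {P X T : D} [Simple T] {f : P ⟶ X}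
    (hf : ∀ m : Subobject P, IsCoatom m → kernelSubobject f ≤ m) (g : P ⟶ T) :
    kernel.ι f ≫ g = 0 := by
  by_cases hg : g = 0
  · rw [hg, comp_zero]
  · rw [← kernelSubobject_arrow',
      ← Subobject.ofLE_arrow (hf _ (isCoatom_kernelSubobject_of_simple hg)), Category.assoc,
      Category.assoc, kernelSubobject_arrow_comp, comp_zero, comp_zero]

theorem FiniteLengthObj.exists_ne_zero_to_simple {X : D} (hX : FiniteLengthObj X)
    (h0 : ¬ IsZero X) : ∃ (S : D) (_ : Simple S) (f : X ⟶ S), f ≠ 0 := by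
  obtain ⟨n, f, hbot, htop, hf⟩ := hX
  obtain _ | n := n
  · have : (⊥ : Subobject X) = ⊤ := hbot.symm.trans htop
    refine (h0 ?_).elim
    have h1 : (⊤ : Subobject X).arrow = 0 := by rw [← this, Subobject.bot_arrow]
    rw [IsZero.iff_id_eq_zero, ← cancel_epi (⊤ : Subobject X).arrow, h1, zero_comp, zero_comp]
  · obtain ⟨h, hS⟩ := hf (Fin.last n)
    have : IsIso (f (Fin.last n).succ).arrow := by
      rw [Fin.succ_last, htop]; infer_instance
    refine ⟨_, hS, inv (f (Fin.last n).succ).arrow ≫ cokernel.π _, fun hz ↦ ?_⟩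
    exact Simple.not_isZero _ (IsZero.of_epi_eq_zero _ hz)

section Splicing

variable {Ω P : ℕ → D} {π : ∀ n, P n ⟶ Ω n} {ι : ∀ n, Ω (n + 1) ⟶ P n}
  (w : ∀ n, ι n ≫ π n = 0)

/-- The complex obtained by splicing complexes `Ω (n + 1) ⟶ P n ⟶ Ω n`. -/
noncomputable def splicedComplex : ChainComplex D ℕ :=
  ChainComplex.of P (fun n ↦ π (n + 1) ≫ ι n) (fun n ↦ by
    rw [Category.assoc, reassoc_of% (w (n + 1)), zero_comp, comp_zero])

theorem splicedComplex_d (n : ℕ) : (splicedComplex w).d (n + 1) n = π (n + 1) ≫ ι n :=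
  ChainComplex.of_d P (fun n ↦ π (n + 1) ≫ ι n) n

variable {w}

theorem exact_comp_of_shortExact (hS : ∀ n, (ShortComplex.mk (ι n) (π n) (w n)).ShortExact)
    (n : ℕ) {Z : D} (j : Ω n ⟶ Z) [Mono j] :
    (ShortComplex.mk (π (n + 1) ≫ ι n) (π n ≫ j) (by
      rw [Category.assoc, reassoc_of% (w n), zero_comp, comp_zero])).Exact := by
  have := (hS (n + 1)).epi_g
  let S := ShortComplex.mk (ι n) (π n ≫ j) (by rw [reassoc_of% (w n), zero_comp])
  let α : ShortComplex.mk (π (n + 1) ≫ ι n) (π n ≫ j) (by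
      rw [Category.assoc, reassoc_of% (w n), zero_comp, comp_zero]) ⟶ S :=
    { τ₁ := π (n + 1), τ₂ := 𝟙 _, τ₃ := 𝟙 _ }
  let β : ShortComplex.mk (ι n) (π n) (w n) ⟶ S := { τ₁ := 𝟙 _, τ₂ := 𝟙 _, τ₃ := j }
  have : Epi α.τ₁ := this
  have : IsIso α.τ₂ := inferInstanceAs (IsIso (𝟙 _))
  have : Mono α.τ₃ := inferInstanceAs (Mono (𝟙 _))
  have : Epi β.τ₁ := inferInstanceAs (Epi (𝟙 _))
  have : IsIso β.τ₂ := inferInstanceAs (IsIso (𝟙 _))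
  have : Mono β.τ₃ := inferInstanceAs (Mono j)
  rw [ShortComplex.exact_iff_of_epi_of_isIso_of_mono α,
    ← ShortComplex.exact_iff_of_epi_of_isIso_of_mono β]
  exact (hS n).exact

/-- Splicing short exact sequences `0 ⟶ Ω (n + 1) ⟶ P n ⟶ Ω n ⟶ 0` with projective middle
terms yields a projective resolution of `Ω 0`. -/
noncomputable def splicedResolution (hP : ∀ n, Projective (P n))
    (hS : ∀ n, (ShortComplex.mk (ι n) (π n) (w n)).ShortExact) :
    ProjectiveResolution (Ω 0) where
  complex := splicedComplex w
  projective := hP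
  π := (ChainComplex.toSingle₀Equiv _ _).symm ⟨π 0, by
    rw [splicedComplex_d]
    exact (Category.assoc (π 1) (ι 0) (π 0)).trans ((congrArg (π 1 ≫ ·) (w 0)).trans comp_zero)⟩
  quasiIso := ⟨fun n ↦ by
    obtain _ | n := n
    · rw [ChainComplex.quasiIsoAt₀_iff, ShortComplex.quasiIso_iff_of_zeros']
      · refine (ShortComplex.exact_and_epi_g_iff_of_iso ?_).2
          ⟨exact_comp_of_shortExact hS 0 (𝟙 _), by
            have := (hS 0).epi_g
            dsimp at this ⊢
            infer_instance⟩
        refine ShortComplex.isoMk (Iso.refl _) (Iso.refl _) (Iso.refl _) ?_ ?_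
        · refine (Category.id_comp _).trans (Eq.trans ?_ (Category.comp_id _).symm)
          exact (splicedComplex_d w 0).symm
        · refine (Category.id_comp _).trans ((Category.comp_id (π 0)).trans ?_)
          exact (Eq.trans (Category.comp_id _)
            (ChainComplex.toSingle₀Equiv_symm_apply_f_zero (C := splicedComplex w) (π 0) _)).symm
      all_goals rfl
    · rw [quasiIsoAt_iff_exactAt']
      · rw [HomologicalComplex.exactAt_iff' _ (n + 1 + 1) (n + 1) n (by simp) (by simp)]
        have := (hS n).mono_f
        refine (ShortComplex.exact_iff_of_iso ?_).2 (exact_comp_of_shortExact hS (n + 1) (ι n))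
        refine ShortComplex.isoMk (Iso.refl _) (Iso.refl _) (Iso.refl _) ?_ ?_
        · refine (Category.id_comp _).trans (Eq.trans ?_ (Category.comp_id _).symm)
          exact (splicedComplex_d w (n + 1)).symm
        · refine (Category.id_comp _).trans (Eq.trans ?_ (Category.comp_id _).symm)
          exact (splicedComplex_d w n).symm
      · apply ChainComplex.exactAt_succ_single_obj⟩

end Splicing

/-- In a category with projective covers, every object has a projective resolution all of whose
differentials are annihilated by morphisms to simple objects. -/
theorem HasProjectiveCovers.exists_minimal_resolution (hD : HasProjectiveCovers D) (X : D) :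
    ∃ P : ProjectiveResolution X, ∀ (n : ℕ) (T : D) (_ : Simple T) (g : P.complex.X n ⟶ T),
      P.complex.d (n + 1) n ≫ g = 0 := by
  choose P hP π hπ hker using hD
  let Ω : ℕ → D := fun n ↦ Nat.rec (motive := fun _ ↦ D) X (fun _ Y ↦ kernel (π Y)) n
  let ι : ∀ n, Ω (n + 1) ⟶ P (Ω n) := fun n ↦ kernel.ι (π (Ω n))
  have w : ∀ n, ι n ≫ π (Ω n) = 0 := fun n ↦ kernel.condition (π (Ω n))
  have hS : ∀ n, (ShortComplex.mk (ι n) (π (Ω n)) (w n)).ShortExact := fun n ↦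
    { exact := ShortComplex.exact_of_f_is_kernel _ (kernelIsKernel (π (Ω n)))
      mono_f := inferInstanceAs (Mono (kernel.ι (π (Ω n))))
      epi_g := hπ (Ω n) }
  refine ⟨splicedResolution (fun n ↦ hP (Ω n)) hS, fun n T hT g ↦ ?_⟩
  have hg : ι n ≫ g = 0 := kernel_ι_comp_eq_zero_of_simple (hker (Ω n)) g
  refine (congrArg (· ≫ g) (splicedComplex_d w n)).trans ?_
  exact (Category.assoc (π (Ω (n + 1))) (ι n) g).trans
    ((congrArg (π (Ω (n + 1)) ≫ ·) hg).trans comp_zero)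

/-- If `T` is simple of injective dimension at most `t`, a minimal projective resolution has no
nonzero morphism to `T` in degrees larger than `t`. -/
theorem eq_zero_of_minimal_resolution_of_injDim_le {X T : D} (P : ProjectiveResolution X)
    (hP : ∀ (n : ℕ) (g : P.complex.X n ⟶ T), P.complex.d (n + 1) n ≫ g = 0)
    {t : ℕ} (hT : injDim T ≤ t) {j : ℕ} (hj : t < j) (f : P.complex.X j ⟶ T) : f = 0 := by
  obtain ⟨n, hn⟩ := iInf_lt_iff.1 (hT.trans_lt (by exact_mod_cast hj : (t : ℕ∞) < j))
  obtain ⟨⟨I, hI⟩, hn⟩ := iInf_lt_iff.1 hn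
  have hnj : n < j := by exact_mod_cast hn
  let := HasExt.standard D
  have h0 : P.extMk f (j + 1) rfl (hP j f) = 0 := by
    obtain ⟨a, ha, h⟩ := I.extMk_surjective (P.extMk f (j + 1) rfl (hP j f)) (j + 1) rfl
    rw [← h]
    obtain rfl : a = 0 := (hI j hnj).eq_of_tgt _ _
    exact I.extMk_zero _ rfl
  obtain _ | j := j
  · lia
  · obtain ⟨g, rfl⟩ := (P.extMk_eq_zero_iff f _ rfl (hP _ f) j rfl).1 h0
    exact hP j g

namespace Recollement

variable {A : Type u₁} {B : Type u₂} {C : Type u₃}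
  [Category.{v₁} A] [Category.{v₂} B] [Category.{v₃} C] [Abelian A] [Abelian B] [Abelian C]
  (R : Recollement A B C)

theorem isZero_e_i (X : A) : IsZero (R.e.obj (R.i.obj X)) :=
  (R.essImage_i_eq_ker_e _).1 (R.i.obj_mem_essImage X)

theorem simple_i_obj (S : A) [Simple S] : Simple (R.i.obj S) where
  mono_isIso_iff_nonzero {Y} f _ := by
    have := R.i_full
    have := R.i_faithful
    have := R.adj_le.rightAdjoint_preservesLimits
    have := R.adj_ip.leftAdjoint_preservesColimits
    have hY : IsZero (R.e.obj Y) := IsZero.of_mono (R.e.map f) (R.isZero_e_i S)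
    obtain ⟨Z, ⟨φ⟩⟩ := (R.essImage_i_eq_ker_e Y).2 hY
    obtain ⟨g, hg⟩ := R.i.map_surjective (φ.hom ≫ f)
    have : Mono g := R.i.mono_of_mono_map (by rw [hg]; infer_instance)
    calc
      IsIso f ↔ IsIso (R.i.map g) := by rw [hg, isIso_comp_left_iff]
      _ ↔ IsIso g := isIso_iff_of_reflects_iso g R.i
      _ ↔ g ≠ 0 := Simple.mono_isIso_iff_nonzero g
      _ ↔ f ≠ 0 := not_congr (by
        rw [← R.i.map_eq_zero_iff, hg]
        exact ⟨fun h ↦ by rwa [← cancel_epi φ.hom, comp_zero], fun h ↦ by rw [h, comp_zero]⟩)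

theorem exists_iso_l_obj (P : B) [Projective P] (hq : IsZero (R.q.obj P)) :
    ∃ Q : C, Projective Q ∧ Nonempty (P ≅ R.l.obj Q) := by
  have := R.l_full
  have := R.l_faithful
  have := R.adj_le.rightAdjoint_preservesLimits
  have := R.adj_er.leftAdjoint_preservesColimits
  have hi {Y Z : B} (hY : IsZero (R.q.obj Y)) (hZ : IsZero (R.e.obj Z)) (f : Y ⟶ Z) : f = 0 := by
    obtain ⟨W, ⟨φ⟩⟩ := (R.essImage_i_eq_ker_e Z).2 hZ
    rw [← cancel_mono φ.inv, zero_comp]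
    exact (R.adj_qi.homEquiv _ _).symm.injective (hY.eq_of_src _ _)
  let ε : R.l.obj (R.e.obj P) ⟶ P := R.adj_le.counit.app P
  have hε : IsIso (R.e.map ε) := inferInstanceAs (IsIso (R.e.map (R.adj_le.counit.app P)))
  have : Epi ε := by
    refine Preadditive.epi_of_cokernel_zero (hi hq ?_ _)
    have := (inferInstance : PreservesColimit (parallelPair ε 0) R.e)
    exact ((isZero_cokernel_of_epi (R.e.map ε)).of_iso (PreservesCokernel.iso R.e ε))
  let s := Projective.factorThru (𝟙 P) ε
  have hs : s ≫ ε = 𝟙 P := Projective.factorThru_comp _ _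
  have hs' : ε ≫ s = 𝟙 (R.l.obj (R.e.obj P)) := by
    apply (R.adj_le.homEquiv _ _).injective
    have : R.e.map (ε ≫ s) = 𝟙 _ := by
      rw [← cancel_mono (R.e.map ε), ← R.e.map_comp, Category.assoc, hs, Category.comp_id,
        Category.id_comp]
    rw [R.adj_le.homEquiv_unit, R.adj_le.homEquiv_unit, this, R.e.map_id]
  let φ : R.l.obj (R.e.obj P) ≅ P := ⟨ε, s, hs', hs⟩
  exact ⟨R.e.obj P, R.adj_le.projective_of_map_projective _ (Projective.of_iso φ.symm ‹_›),
    ⟨φ.symm⟩⟩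

end Recollement

end Auxiliary

/-- Let `(𝒜, ℬ, 𝒞)` be a recollement of abelian categories such that `𝒜` is a finite length
category, `ℬ` has enough projectives and projective covers, and `𝒞` has enough projectives.
Assume `id_ℬ i(A) ≤ t` for every object `A` of `𝒜`.  Then every object `B` of `ℬ` has a
projective resolution `⋯ → l(Q₁) → l(Q₀) → P_t → ⋯ → P₀ → B → 0` where each `Q_j` is a
projective object of `𝒞` (and each `P_i` is, of course, a projective object of `ℬ`). -/
theorem recollement_truncated_projective_resolution {A : Type u₁} {B : Type u₂} {C : Type u₃}
    [Category.{v₁} A] [Category.{v₂} B] [Category.{v₃} C]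
    [Abelian A] [Abelian B] [Abelian C]
    [EnoughProjectives B] [EnoughProjectives C]
    (R : Recollement A B C)
    (hA : FiniteLengthCategory A) (hB : HasProjectiveCovers B)
    (t : ℕ) (h : ∀ X : A, injDim (R.i.obj X) ≤ (t : ℕ∞)) :
    ∀ X : B, ∃ P : CategoryTheory.ProjectiveResolution X,
      ∀ j : ℕ, t < j → ∃ Q : C, Projective Q ∧ Nonempty (P.complex.X j ≅ R.l.obj Q) := by
  intro X
  obtain ⟨P, hP⟩ := hB.exists_minimal_resolution X
  refine ⟨P, fun j hj ↦ R.exists_iso_l_obj _ (by_contra fun hq ↦ ?_)⟩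
  obtain ⟨S, _, f, hf⟩ := (hA (R.q.obj (P.complex.X j))).exists_ne_zero_to_simple hq
  have hS := R.simple_i_obj S
  apply hf
  apply (R.adj_qi.homEquiv _ _).injective
  have H := eq_zero_of_minimal_resolution_of_injDim_le P (fun n ↦ hP n _ hS) (h S) hj
  rw [H (R.adj_qi.homEquiv _ _ f), H (R.adj_qi.homEquiv _ _ 0)]
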